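/- arXiv:1905.00340 — 2 statements merged into one kernel-verified Lean document; each statement's English description precedes it below -/
import Mathlib

section
/- Let G be a finite simple graph, M a module of G with |M| ≥ 2, and S, S' independent sets of G with |S| = |S'| and |M ∩ (S ∪ S')| ≤ 1. Then for every vertex v ∈ M ∖ (S ∪ S'): S ↭ S' in G (under token sliding) if and only if S ↭ S' in the induced subgraph G − v. -/
open Finset

variable {V : Type*}

/-- `S` is an independent set of the simple graph `G`. -/
def IndepF (G : SimpleGraph V) (S : Finset V) : Prop :=
  ∀ u ∈ S, ∀ v ∈ S, ¬ G.Adj u v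

/-- A single `TAR_k` step inside the induced subgraph `G[W]`:
both sets are independent sets of `G` contained in `W`, their symmetric
difference has at most one element, and both have size at least `k`. -/
def TarStepOn [DecidableEq V] (G : SimpleGraph V) (W : Set V) (k : ℤ)
    (A B : Finset V) : Prop :=
  (A : Set V) ⊆ W ∧ (B : Set V) ⊆ W ∧ IndepF G A ∧ IndepF G B ∧
    (symmDiff A B).card ≤ 1 ∧ k ≤ (A.card : ℤ) ∧ k ≤ (B.card : ℤ)

/-- `TAR_k` reachability inside the induced subgraph `G[W]`. -/
def TarReachOn [DecidableEq V] (G : SimpleGraph V) (W : Set V) (k : ℤ) :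
    Finset V → Finset V → Prop :=
  Relation.ReflTransGen (TarStepOn G W k)

/-- A single token-sliding step inside the induced subgraph `G[W]`. -/
def TsStepOn [DecidableEq V] (G : SimpleGraph V) (W : Set V) (A B : Finset V) : Prop :=
  (A : Set V) ⊆ W ∧ (B : Set V) ⊆ W ∧ IndepF G A ∧ IndepF G B ∧
    ∃ x y, G.Adj x y ∧ symmDiff A B = {x, y}

/-- Token-sliding (`TS`) reachability inside the induced subgraph `G[W]`. -/
def TsReachOn [DecidableEq V] (G : SimpleGraph V) (W : Set V) :
    Finset V → Finset V → Prop :=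
  Relation.ReflTransGen (TsStepOn G W)

/-- `M` is a module of `G`. -/
def IsModule [DecidableEq V] (G : SimpleGraph V) (M : Finset V) : Prop :=
  ∀ u ∈ M, ∀ v ∈ M, ∀ w, w ∉ M → (G.Adj u w ↔ G.Adj v w)

/-- The open neighborhood `N(M)` of the vertex set `M`: vertices outside `M`
adjacent to some vertex of `M`. -/
def NbhdSet (G : SimpleGraph V) (M : Finset V) : Set V :=
  {w | w ∉ M ∧ ∃ v ∈ M, G.Adj v w}

/-- `lam G W S k` : the largest size of an independent set reachable from `S`
under `TAR_k` inside the induced subgraph `G[W]`. -/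
noncomputable def lam [DecidableEq V] (G : SimpleGraph V) (W : Set V)
    (S : Finset V) (k : ℤ) : ℕ :=
  sSup {n | ∃ T : Finset V, TarReachOn G W k S T ∧ T.card = n}

/-- A single token-jumping step: both sets are independent, of equal size,
and their symmetric difference has exactly two elements. -/
def TjStep [DecidableEq V] (G : SimpleGraph V) (A B : Finset V) : Prop :=
  IndepF G A ∧ IndepF G B ∧ A.card = B.card ∧ (symmDiff A B).card = 2

/-- Token-jumping (`TJ`) reachability. -/
def TjReach [DecidableEq V] (G : SimpleGraph V) : Finset V → Finset V → Prop :=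
  Relation.ReflTransGen (TjStep G)

/-- A token-sliding step moves one token `x` along an edge to a vertex `y`. -/
theorem TsStepOn.exists_slide [DecidableEq V] {G : SimpleGraph V} {W : Set V} {A B : Finset V}
    (h : TsStepOn G W A B) :
    ∃ x y, G.Adj x y ∧ x ∈ A ∧ y ∉ A ∧ ∀ z, z ∈ B ↔ z = y ∨ z ∈ A ∧ z ≠ x := by
  obtain ⟨-, -, hA, hB, x, y, hxy, hs⟩ := h
  have hmem : ∀ z, (z ∈ A ∧ z ∉ B ∨ z ∈ B ∧ z ∉ A) ↔ z = x ∨ z = y := fun z => by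
    rw [← Finset.mem_symmDiff, hs, Finset.mem_insert, Finset.mem_singleton]
  have hne := hxy.ne
  have hAxy := fun hx hy => hA x hx y hy hxy
  have hBxy := fun hx hy => hB x hx y hy hxy
  by_cases hxA : x ∈ A
  · exact ⟨x, y, hxy, hxA, by grind, by grind⟩
  · exact ⟨y, x, hxy.symm, by grind, hxA, by grind⟩

theorem TsReachOn.mono [DecidableEq V] {G : SimpleGraph V} {W W' : Set V} (hW : W ⊆ W')
    {A B : Finset V} (h : TsReachOn G W A B) : TsReachOn G W' A B :=
  Relation.ReflTransGen.mono
    (fun _ _ ⟨hA, hB, hstep⟩ => ⟨hA.trans hW, hB.trans hW, hstep⟩) A B h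

/-- Replace all tokens of `A` inside `M`, if any, by a single token on `u`. -/
def collapse [DecidableEq V] (M : Finset V) (u : V) (A : Finset V) : Finset V :=
  if (A ∩ M).Nonempty then insert u (A \ M) else A

theorem mem_collapse [DecidableEq V] {M A : Finset V} {u z : V} :
    z ∈ collapse M u A ↔ z ∈ A ∧ z ∉ M ∨ z = u ∧ ∃ m ∈ A, m ∈ M := by
  simp only [collapse, Finset.Nonempty, Finset.mem_inter]
  split_ifs <;> grind

theorem collapse_eq_self [DecidableEq V] {M A : Finset V} {u : V}
    (h : ∀ a ∈ A, a ∈ M → a = u) : collapse M u A = A := by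
  ext z
  rw [mem_collapse]
  grind

theorem IndepF.collapse [DecidableEq V] {G : SimpleGraph V} {M A : Finset V} {u : V}
    (hM : IsModule G M) (hu : u ∈ M) (hA : IndepF G A) : IndepF G (collapse M u A) := by
  intro a ha b hb hab
  rw [mem_collapse] at ha hb
  rcases ha with ⟨ha, haM⟩ | ⟨rfl, m, hm, hmM⟩ <;> rcases hb with ⟨hb, hbM⟩ | ⟨rfl, n, hn, hnM⟩
  · exact hA a ha b hb hab
  · exact hA n hn a ha ((hM b hu n hnM a haM).1 hab.symm)
  · exact hA m hm b hb ((hM a hu m hmM b hbM).1 hab)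
  · exact hab.ne rfl

/-- A token can enter a module only when the module contains no other token, so token sliding
preserves having at most one token in a module. -/
theorem TsStepOn.inter_subsingleton [DecidableEq V] {G : SimpleGraph V} {W : Set V}
    {M A B : Finset V} (hM : IsModule G M) (h : TsStepOn G W A B)
    (hA : ∀ a ∈ A, a ∈ M → ∀ b ∈ A, b ∈ M → a = b) :
    ∀ a ∈ B, a ∈ M → ∀ b ∈ B, b ∈ M → a = b := by
  obtain ⟨x, y, hxy, hx, -, hB⟩ := h.exists_slide
  have hAi := h.2.2.1
  have hempty : x ∉ M → y ∈ M → ∀ a ∈ A, a ∉ M := fun hxM hyM a ha haM =>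
    hAi a ha x hx ((hM y hyM a haM x hxM).1 hxy.symm)
  grind

theorem TsStepOn.collapse [DecidableEq V] {G : SimpleGraph V} {W W' : Set V}
    {M A B : Finset V} {u : V} (hM : IsModule G M) (hu : u ∈ M) (h : TsStepOn G W A B)
    (hA : ∀ a ∈ A, a ∈ M → ∀ b ∈ A, b ∈ M → a = b) (hW : W \ M ⊆ W') (huW : u ∈ W') :
    TsReachOn G W' (collapse M u A) (collapse M u B) := by
  have hsub : ∀ {C : Finset V}, (C : Set V) ⊆ W → (_root_.collapse M u C : Set V) ⊆ W' := by
    intro C hC z hz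
    rcases mem_collapse.1 (Finset.mem_coe.1 hz) with ⟨hz, hzM⟩ | ⟨rfl, -⟩
    · exact hW ⟨hC hz, hzM⟩
    · exact huW
  have hslide : ∀ p q, G.Adj p q →
      symmDiff (_root_.collapse M u A) (_root_.collapse M u B) = {p, q} →
      TsReachOn G W' (_root_.collapse M u A) (_root_.collapse M u B) := fun p q hpq hs =>
    .single ⟨hsub h.1, hsub h.2.1, h.2.2.1.collapse hM hu, h.2.2.2.1.collapse hM hu,
      p, q, hpq, hs⟩
  have hBs := h.inter_subsingleton hM hA
  obtain ⟨x, y, hxy, hx, hy, hB⟩ := h.exists_slide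
  have hyB : y ∈ B := (hB y).2 (.inl rfl)
  by_cases hxM : x ∈ M <;> by_cases hyM : y ∈ M
  · have : _root_.collapse M u A = _root_.collapse M u B := by
      ext z
      simp only [mem_collapse]
      grind
    rw [this]
    exact .refl
  · refine hslide u y ((hM u hu x hxM y hyM).2 hxy) ?_
    ext z
    simp only [Finset.mem_symmDiff, mem_collapse, Finset.mem_insert, Finset.mem_singleton]
    grind
  · refine hslide x u ((hM u hu y hyM x hxM).2 hxy.symm).symm ?_
    have hAM : ∀ a ∈ A, a ∉ M := by grind
    ext z
    simp only [Finset.mem_symmDiff, mem_collapse, Finset.mem_insert, Finset.mem_singleton]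
    grind
  · refine hslide x y hxy ?_
    ext z
    simp only [Finset.mem_symmDiff, mem_collapse, Finset.mem_insert, Finset.mem_singleton]
    grind

theorem TsReachOn.collapse [DecidableEq V] {G : SimpleGraph V} {W W' : Set V}
    {M A B : Finset V} {u : V} (hM : IsModule G M) (hu : u ∈ M) (h : TsReachOn G W A B)
    (hA : ∀ a ∈ A, a ∈ M → ∀ b ∈ A, b ∈ M → a = b) (hW : W \ M ⊆ W') (huW : u ∈ W') :
    TsReachOn G W' (collapse M u A) (collapse M u B) := by
  induction h using Relation.ReflTransGen.head_induction_on with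
  | refl => exact .refl
  | head hstep _ ih =>
    exact (hstep.collapse hM hu hA hW huW).trans (ih (hstep.inter_subsingleton hM hA))

/-- Let `M` be a module of `G` with `|M| ≥ 2` and `S, S'`
independent sets of `G` with `|S| = |S'|` and `|M ∩ (S ∪ S')| ≤ 1`. Then for
every `v ∈ M \ (S ∪ S')`: `S ↭ S'` in `G` under token sliding iff `S ↭ S'`
in `G - v`. -/
theorem stmt9 {V : Type*} [Fintype V] [DecidableEq V] (G : SimpleGraph V)
    (M : Finset V) (hM : IsModule G M) (hMcard : 2 ≤ M.card)
    (S S' : Finset V) (hS : IndepF G S) (hS' : IndepF G S')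
    (hcard : S.card = S'.card) (hint : (M ∩ (S ∪ S')).card ≤ 1)
    (v : V) (hvM : v ∈ M) (hv : v ∉ S ∪ S') :
    TsReachOn G Set.univ S S' ↔ TsReachOn G ({v}ᶜ : Set V) S S' := by
  refine ⟨fun h => ?_, fun h => h.mono (Set.subset_univ _)⟩
  have hone : ∀ a ∈ M ∩ (S ∪ S'), ∀ b ∈ M ∩ (S ∪ S'), a = b :=
    fun a ha b hb => Finset.card_le_one.1 hint a ha b hb
  obtain ⟨u, huM, huv, hu⟩ : ∃ u ∈ M, u ≠ v ∧ ∀ a ∈ M ∩ (S ∪ S'), a = u := by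
    rcases (M ∩ (S ∪ S')).eq_empty_or_nonempty with he | ⟨u, hu⟩
    · obtain ⟨u, hu, huv⟩ := Finset.exists_mem_ne hMcard v
      exact ⟨u, hu, huv, by simp [he]⟩
    · exact ⟨u, (Finset.mem_inter.1 hu).1, by grind, fun a ha => hone a ha u hu⟩
  have hSu : ∀ a ∈ S, a ∈ M → a = u := fun a ha haM => hu a (by grind)
  have hSu' : ∀ a ∈ S', a ∈ M → a = u := fun a ha haM => hu a (by grind)
  have key := h.collapse (W' := ({v}ᶜ : Set V)) hM huM
    (fun a ha haM b hb hbM => (hSu a ha haM).trans (hSu b hb hbM).symm)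
    (fun z hz hzv => hz.2 (Set.mem_singleton_iff.1 hzv ▸ hvM)) huv
  rwa [collapse_eq_self hSu, collapse_eq_self hSu'] at key
end

section
/- Let G be a finite simple graph and M a module of G such that M is itself an independent set of G (the induced subgraph G[M] has no edges). Let S be an independent set of G with S ∩ M ≠ ∅. Then S ∪ M is an independent set of G, and for every integer k with k ≤ |S|, S ↭_k (S ∪ M) in G. -/
open Finset

variable {V : Type*}

theorem IndepF.mono {G : SimpleGraph V} {A B : Finset V} (hB : IndepF G B) (h : A ⊆ B) :
    IndepF G A :=
  fun u hu v hv => hB u (h hu) v (h hv)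

/-- Growing an independent set one vertex at a time inside an independent superset. -/
theorem IndepF.tarReachOn_union [DecidableEq V] {G : SimpleGraph V} {S T : Finset V}
    (h : IndepF G (S ∪ T)) {k : ℤ} (hk : k ≤ (S.card : ℤ)) :
    TarReachOn G Set.univ k S (S ∪ T) := by
  induction T using Finset.induction_on with
  | empty => rw [union_empty]; exact Relation.ReflTransGen.refl
  | insert a T _ ih =>
    have hsub : S ∪ T ⊆ S ∪ insert a T := union_subset_union_right (subset_insert a T)
    refine (ih (h.mono hsub)).tail
      ⟨Set.subset_univ _, Set.subset_univ _, h.mono hsub, h, ?_, ?_, ?_⟩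
    · refine (card_le_card (t := {a}) fun x hx => ?_).trans (card_singleton a).le
      simp only [mem_symmDiff, mem_union, mem_insert] at hx
      rw [mem_singleton]
      tauto
    · exact hk.trans (mod_cast card_le_card subset_union_left)
    · exact hk.trans (mod_cast card_le_card subset_union_left)

theorem IsModule.indepF_union [DecidableEq V] {G : SimpleGraph V} {M S : Finset V}
    (hM : IsModule G M) (hMind : IndepF G M) (hS : IndepF G S) (hSM : (S ∩ M).Nonempty) :
    IndepF G (S ∪ M) := by
  obtain ⟨x, hx⟩ := hSM
  rw [mem_inter] at hx
  have key : ∀ u ∈ S, ∀ v ∈ M, ¬ G.Adj v u := fun u hu v hv huv => by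
    by_cases huM : u ∈ M
    · exact hMind v hv u huM huv
    · exact hS x hx.1 u hu ((hM v hv x hx.2 u huM).1 huv)
  intro u hu v hv huv
  rcases mem_union.1 hu with hu | hu <;> rcases mem_union.1 hv with hv | hv
  · exact hS u hu v hv huv
  · exact key u hu v hv huv.symm
  · exact key v hv u hu huv
  · exact hMind u hu v hv huv

/-- Let `G` be a finite simple graph and `M` a module of `G`
that is itself an independent set of `G`. Let `S` be an independent set of
`G` with `S ∩ M ≠ ∅`. Then `S ∪ M` is an independent set of `G`, and for
every integer `k ≤ |S|`, `S ↭_k (S ∪ M)` in `G`. -/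
theorem stmt13 {V : Type*} [Fintype V] [DecidableEq V] (G : SimpleGraph V)
    (M : Finset V) (hM : IsModule G M) (hMind : IndepF G M)
    (S : Finset V) (hS : IndepF G S) (hSM : S ∩ M ≠ ∅) :
    IndepF G (S ∪ M) ∧
      ∀ k : ℤ, k ≤ (S.card : ℤ) → TarReachOn G Set.univ k S (S ∪ M) := by
  have h := hM.indepF_union hMind hS (nonempty_iff_ne_empty.2 hSM)
  exact ⟨h, fun _ hk => h.tarReachOn_union hk⟩
end
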